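/- There exists a constant c > 0 such that for every connected string graph G with n vertices and m ≥ 1 edges, the optimal vertex congestion satisfies vcong(G) ≥ c·n²/√m. -/

import Mathlib

open Finset

/-- A curve from `x` to `y`: the image of a continuous map `[0,1] → ℝ²`
with prescribed endpoints. -/
def IsArc (c : Set (ℝ × ℝ)) (x y : ℝ × ℝ) : Prop :=
  ∃ f : ℝ → ℝ × ℝ, ContinuousOn f (Set.Icc 0 1) ∧ c = f '' Set.Icc 0 1 ∧
    f 0 = x ∧ f 1 = y

/-- A curve: the image of a continuous map `[0,1] → ℝ²`. -/
def IsCurve (c : Set (ℝ × ℝ)) : Prop := ∃ x y, IsArc c x y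

/-- `G` is a string graph: an intersection graph of curves in the plane. -/
def SimpleGraph.IsStringGraph {V : Type*} (G : SimpleGraph V) : Prop :=
  ∃ γ : V → Set (ℝ × ℝ), (∀ v, IsCurve (γ v)) ∧
    ∀ u v : V, (γ u ∩ γ v).Nonempty ↔ (G.Adj u v ∨ u = v)

/-- `S` is a separator in `G`. -/
def SimpleGraph.IsSeparator {V : Type*} [Fintype V] [DecidableEq V]
    (G : SimpleGraph V) (S : Finset V) : Prop :=
  ∃ V₁ V₂ : Finset V, V₁ ∪ V₂ ∪ S = Finset.univ ∧
    Disjoint V₁ V₂ ∧ Disjoint V₁ S ∧ Disjoint V₂ S ∧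
    3 * V₁.card ≤ 2 * Fintype.card V ∧ 3 * V₂.card ≤ 2 * Fintype.card V ∧
    ∀ u ∈ V₁, ∀ v ∈ V₂, ¬ G.Adj u v

section Flows

variable {V : Type*} [Fintype V] (G : SimpleGraph V)

/-- An all-pair unit-demand multicommodity flow in `G`, presented symmetrically on
ordered pairs: `φ u v p = φ v u p.reverse` represents the flow on the (undirected)
path `p ∈ 𝒫_{uv}`, and the flows on `𝒫_{uv}` sum to `1` for every pair `u ≠ v`. -/
def SimpleGraph.IsMCFlow (φ : ∀ u v : V, G.Path u v → ℝ) : Prop :=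
  letI := Classical.decEq V
  letI : DecidableRel G.Adj := fun _ _ => Classical.dec _
  (∀ u v p, φ u v p ∈ Set.Icc (0 : ℝ) 1) ∧
  (∀ u v (p : G.Path u v), φ v u p.reverse = φ u v p) ∧
  (∀ u v : V, u ≠ v → ∑ p : G.Path u v, φ u v p = 1)

/-- The coefficient with which a path `p` counts towards the congestion of `w`:
`1` if `w` is an internal vertex of `p`, `1/2` if `w` is an endpoint of `p`. -/
noncomputable def pathCoeff (w : V) {u v : V} (p : G.Walk u v) : ℝ :=
  letI := Classical.decEq V
  if w ∈ p.support then (if w = u ∨ w = v then 1 / 2 else 1) else 0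

/-- The congestion of a vertex `w` under the flow `φ`; the factor `1/2` compensates
the fact that each undirected path is counted by both its orientations. -/
noncomputable def SimpleGraph.congestion (φ : ∀ u v : V, G.Path u v → ℝ) (w : V) : ℝ :=
  letI := Classical.decEq V
  letI : DecidableRel G.Adj := fun _ _ => Classical.dec _
  (1 / 2) * ∑ u : V, ∑ v : V, ∑ p : G.Path u v, φ u v p * pathCoeff G w p.1

/-- The optimal vertex congestion `vcong G`. -/
noncomputable def SimpleGraph.vcong : ℝ :=
  sInf { x : ℝ | ∃ φ : ∀ u v : V, G.Path u v → ℝ,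
    G.IsMCFlow φ ∧ x = ⨆ w : V, G.congestion φ w }

/-- `vcong* G`: the minimum of `vcong H` over all subgraphs `H` of `G` on at least
two thirds of the vertices. -/
noncomputable def SimpleGraph.vcongStar : ℝ :=
  sInf { x : ℝ | ∃ H : G.Subgraph, 2 * Fintype.card V ≤ 3 * H.verts.ncard ∧
    x = letI : Fintype ↥H.verts := H.verts.toFinite.fintype
        H.coe.vcong }

end Flows



theorem exists_log_lift {A : Type*} [TopologicalSpace A] [SimplyConnectedSpace A]
    [LocallyPathConnectedSpace A] (h : A → ℂ) (hc : Continuous h) (h0 : ∀ a, h a ≠ 0) :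
    ∃ F : A → ℂ, Continuous F ∧ ∀ a, Complex.exp (F a) = h a := by
  obtain ⟨a₀⟩ : Nonempty A := inferInstance
  obtain ⟨F, ⟨-, hF⟩, -⟩ := Complex.isCoveringMapOn_exp.existsUnique_continuousMap_lifts
    (⟨h, hc⟩ : C(A, ℂ)) (a₀ := a₀) (e₀ := Complex.log (h a₀))
    (by simpa using Complex.exp_log (h0 a₀)) (fun a => by simpa using h0 a)
  exact ⟨F, F.continuous, fun a => congrFun hF a⟩

theorem lift_unique (F F' : ℝ → ℂ) (hF : Continuous F) (hF' : Continuous F')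
    (c : ℂ) (h : ∀ t, Complex.exp (F t) = c * Complex.exp (F' t)) : F 1 - F 0 = F' 1 - F' 0 := by
  have hc : ∀ t, Complex.exp (F t - F' t) = c := by
    intro t
    rw [Complex.exp_sub, h t, mul_div_assoc, div_self (Complex.exp_ne_zero _), mul_one]
  have key : (fun t => F t - F' t) = fun _ => F 0 - F' 0 := by
    have cov := Complex.isCoveringMap_exp
    refine cov.eq_of_comp_eq (hF.sub hF') continuous_const ?_ 0 rfl
    funext t
    simp [hc]
  have := congrFun key 1
  linear_combination this

/-- total change of the logarithm of `f - p` -/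
def LogChange (f : ℝ → ℂ) (p d : ℂ) : Prop :=
  ∃ F : ℝ → ℂ, Continuous F ∧ (∀ t, Complex.exp (F t) = f t - p) ∧ d = F 1 - F 0

theorem LogChange.exists (f : ℝ → ℂ) (hf : Continuous f) (p : ℂ) (h : ∀ t, f t ≠ p) :
    ∃ d, LogChange f p d := by
  obtain ⟨F, hF, h'⟩ := exists_log_lift (fun t => f t - p) (by fun_prop)
    (fun t => sub_ne_zero.2 (h t))
  exact ⟨_, F, hF, h', rfl⟩

theorem LogChange.exp {f : ℝ → ℂ} {p d : ℂ} (h : LogChange f p d) :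
    Complex.exp d * (f 0 - p) = f 1 - p := by
  obtain ⟨F, hF, h', rfl⟩ := h
  rw [← h', ← h', ← Complex.exp_add]
  congr 1
  ring

theorem LogChange.square {f g : ℝ → ℂ} (hf : Continuous f) (hg : Continuous g)
    (hfg : ∀ s t, f s ≠ g t) {dk dl di dj : ℂ}
    (hk : LogChange f (g 0) dk) (hl : LogChange f (g 1) dl)
    (hi : LogChange g (f 0) di) (hj : LogChange g (f 1) dj) : dk + dj = di + dl := by
  obtain ⟨F, hF, h⟩ := exists_log_lift (fun x : ℝ × ℝ => f x.1 - g x.2) (by fun_prop)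
    (fun x => sub_ne_zero.2 (hfg _ _))
  obtain ⟨K, hK, K1, rfl⟩ := hk
  obtain ⟨L, hL, L1, rfl⟩ := hl
  obtain ⟨I, hI, I1, rfl⟩ := hi
  obtain ⟨J, hJ, J1, rfl⟩ := hj
  have e1 := lift_unique K (fun s => F (s, 0)) hK (by fun_prop) 1 (fun t => by rw [K1, h]; ring)
  have e2 := lift_unique L (fun s => F (s, 1)) hL (by fun_prop) 1 (fun t => by rw [L1, h]; ring)
  have e3 := lift_unique I (fun s => F (0, s)) hI (by fun_prop) (-1) (fun t => by rw [I1, h]; ring)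
  have e4 := lift_unique J (fun s => F (1, s)) hJ (by fun_prop) (-1) (fun t => by rw [J1, h]; ring)
  rw [e1, e2, e3, e4]
  ring

def eps (i j : Fin 5) : ℤ := if i < j then 1 else -1

theorem k5_crossing (p : Fin 5 → ℂ) (f : Fin 5 → Fin 5 → ℝ → ℂ)
    (hf : ∀ i j, i < j → Continuous (f i j)) (h0 : ∀ i j, i < j → f i j 0 = p i)
    (h1 : ∀ i j, i < j → f i j 1 = p j) :
    ∃ i j k l, i < j ∧ k < l ∧ i ≠ k ∧ i ≠ l ∧ j ≠ k ∧ j ≠ l ∧ ∃ s t, f i j s = f k l t := by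
  by_contra hcon
  have H : ∀ i j k l, i < j → k < l → i ≠ k → i ≠ l → j ≠ k → j ≠ l → ∀ s t, f i j s ≠ f k l t := by
    intro i j k l a b c d e g s t hst
    exact hcon ⟨i, j, k, l, a, b, c, d, e, g, s, t, hst⟩
  have hav : ∀ i k l, k < l → i ≠ k → i ≠ l → ∀ t, f k l t ≠ p i := by
    intro i k l hkl hik hil t
    obtain ⟨j, hji, hjk, hjl⟩ : ∃ j : Fin 5, j ≠ i ∧ j ≠ k ∧ j ≠ l := by
      clear * -; revert i k l; decide
    rcases lt_or_gt_of_ne hji with h | h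
    · rw [← h1 j i h]; exact (H j i k l h hkl hjk hjl hik hil 1 t).symm
    · rw [← h0 i j h]; exact (H i j k l h hkl hik hil hjk hjl 0 t).symm
  have hne : ∀ i j, i ≠ j → p j - p i ≠ 0 := by
    intro i j hij
    obtain ⟨k, hki, hkj⟩ : ∃ k : Fin 5, k ≠ i ∧ k ≠ j := by
      clear * -; revert i j; decide
    rw [sub_ne_zero]
    rcases lt_or_gt_of_ne hkj with h | h
    · rw [← h1 k j h]; exact hav i k j h hki.symm hij 1
    · rw [← h0 j k h]; exact hav i j k h hij hki.symm 0
  have hD : ∀ i k l, ∃ d, k < l → i ≠ k → i ≠ l → LogChange (f k l) (p i) d := by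
    intro i k l
    by_cases h : k < l ∧ i ≠ k ∧ i ≠ l
    · obtain ⟨d, hd⟩ := LogChange.exists (f k l) (hf k l h.1) (p i) (hav i k l h.1 h.2.1 h.2.2)
      exact ⟨d, fun _ _ _ => hd⟩
    · exact ⟨0, fun a b c => absurd ⟨a, b, c⟩ h⟩
  choose D hD using hD
  let L : Fin 5 → Fin 5 → ℂ := fun i j =>
    if i < j then Complex.log (p j - p i) else Complex.log (p i - p j) + Real.pi * Complex.I
  have hL : ∀ i j, i ≠ j → Complex.exp (L i j) = p j - p i := by
    intro i j hij
    simp only [L]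
    split_ifs with h
    · exact Complex.exp_log (hne i j hij)
    · rw [Complex.exp_add, Complex.exp_pi_mul_I, Complex.exp_log (hne j i hij.symm)]; ring
  have hLe : ∀ i j, i ≠ j → L j i = L i j + eps i j * (Real.pi * Complex.I) := by
    intro i j hij
    rcases lt_or_gt_of_ne hij with h | h
    · simp [L, eps, h, h.not_gt]
    · simp [L, eps, h, h.not_gt]
  have hn : ∀ i k l, ∃ n : ℤ, k < l → i ≠ k → i ≠ l →
      D i k l = L i l - L i k + n * (2 * Real.pi * Complex.I) := by
    intro i k l
    by_cases h : k < l ∧ i ≠ k ∧ i ≠ l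
    · obtain ⟨a, b, c⟩ := h
      have e := (hD i k l a b c).exp
      rw [h0 k l a, h1 k l a, ← hL i k b, ← hL i l c, ← Complex.exp_add,
        Complex.exp_eq_exp_iff_exists_int] at e
      obtain ⟨n, hn⟩ := e
      exact ⟨n, fun _ _ _ => by linear_combination hn⟩
    · exact ⟨0, fun a b c => absurd ⟨a, b, c⟩ h⟩
  choose n hn using hn
  have key : ∀ i j k l, i < j → k < l → i ≠ k → i ≠ l → j ≠ k → j ≠ l →
      2 * (n k i j + n j k l - n l i j - n i k l) + eps j k - eps i k - eps j l + eps i l = 0 := by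
    intro i j k l hij hkl hik hil hjk hjl
    have e := LogChange.square (hf i j hij) (hf k l hkl) (H i j k l hij hkl hik hil hjk hjl)
      (by rw [h0 k l hkl]; exact hD k i j hij hik.symm hjk.symm)
      (by rw [h1 k l hkl]; exact hD l i j hij hil.symm hjl.symm)
      (by rw [h0 i j hij]; exact hD i k l hkl hik hil)
      (by rw [h1 i j hij]; exact hD j k l hkl hjk hjl)
    rw [hn k i j hij hik.symm hjk.symm, hn l i j hij hil.symm hjl.symm, hn i k l hkl hik hil,
      hn j k l hkl hjk hjl, hLe j k hjk, hLe i k hik, hLe j l hjl, hLe i l hil] at e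
    have hpi : (Real.pi * Complex.I : ℂ) ≠ 0 := by simp [Real.pi_ne_zero]
    have : ((2 * (n k i j + n j k l - n l i j - n i k l) + eps j k - eps i k - eps j l + eps i l : ℤ) : ℂ)
        * (Real.pi * Complex.I) = 0 := by
      push_cast
      linear_combination e
    exact_mod_cast (mul_eq_zero.1 this).resolve_right hpi
  have q1 := key 0 1 2 3 (by decide) (by decide) (by decide) (by decide) (by decide) (by decide)
  have q2 := key 0 2 1 3 (by decide) (by decide) (by decide) (by decide) (by decide) (by decide)
  have q3 := key 0 3 1 2 (by decide) (by decide) (by decide) (by decide) (by decide) (by decide)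
  have q4 := key 0 1 2 4 (by decide) (by decide) (by decide) (by decide) (by decide) (by decide)
  have q5 := key 0 2 1 4 (by decide) (by decide) (by decide) (by decide) (by decide) (by decide)
  have q6 := key 0 4 1 2 (by decide) (by decide) (by decide) (by decide) (by decide) (by decide)
  have q7 := key 0 1 3 4 (by decide) (by decide) (by decide) (by decide) (by decide) (by decide)
  have q8 := key 0 3 1 4 (by decide) (by decide) (by decide) (by decide) (by decide) (by decide)
  have q9 := key 0 4 1 3 (by decide) (by decide) (by decide) (by decide) (by decide) (by decide)
  have q10 := key 0 2 3 4 (by decide) (by decide) (by decide) (by decide) (by decide) (by decide)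
  have q11 := key 0 3 2 4 (by decide) (by decide) (by decide) (by decide) (by decide) (by decide)
  have q12 := key 0 4 2 3 (by decide) (by decide) (by decide) (by decide) (by decide) (by decide)
  have q13 := key 1 2 3 4 (by decide) (by decide) (by decide) (by decide) (by decide) (by decide)
  have q14 := key 1 3 2 4 (by decide) (by decide) (by decide) (by decide) (by decide) (by decide)
  have q15 := key 1 4 2 3 (by decide) (by decide) (by decide) (by decide) (by decide) (by decide)
  clear * - q1 q2 q3 q4 q5 q6 q7 q8 q9 q10 q11 q12 q13 q14 q15
  simp [eps] at q1 q2 q3 q4 q5 q6 q7 q8 q9 q10 q11 q12 q13 q14 q15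
  omega

theorem IsCurve.isPathConnected {c : Set (ℝ × ℝ)} (h : IsCurve c) : IsPathConnected c := by
  obtain ⟨x, y, f, hf, rfl, -, -⟩ := h
  exact ((convex_Icc (0:ℝ) 1).isPathConnected ⟨0, by simp⟩).image' hf

theorem walk_joinedIn {V : Type*} {G : SimpleGraph V} (γ : V → Set (ℝ × ℝ))
    (hγ : ∀ v, IsCurve (γ v)) (hadj : ∀ u v, G.Adj u v → (γ u ∩ γ v).Nonempty)
    {u v : V} (p : G.Walk u v) : ∀ x ∈ γ u, ∀ y ∈ γ v, JoinedIn (⋃ w ∈ p.support, γ w) x y := by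
  induction p with
  | nil =>
    intro x hx y hy
    simpa using (hγ _).isPathConnected.joinedIn x hx y hy
  | @cons a b c h q ih =>
    intro x hx y hy
    obtain ⟨z, hz1, hz2⟩ := hadj _ _ h
    refine JoinedIn.trans (((hγ a).isPathConnected.joinedIn x hx z hz1).mono ?_)
      ((ih z hz2 y hy).mono ?_)
    · intro t ht
      exact Set.mem_iUnion₂.2 ⟨a, by simp, ht⟩
    · refine Set.biUnion_mono ?_ (fun _ _ => subset_rfl)
      intro w hw
      exact List.mem_cons_of_mem _ hw

theorem string_touch {V : Type*} {G : SimpleGraph V} (hG : G.IsStringGraph) (x : Fin 5 → V)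
    (P : ∀ i j, i < j → G.Walk (x i) (x j)) :
    ∃ i j k l, ∃ (hij : i < j) (hkl : k < l), i ≠ k ∧ i ≠ l ∧ j ≠ k ∧ j ≠ l ∧
      ∃ a ∈ (P i j hij).support, ∃ b ∈ (P k l hkl).support, G.Adj a b ∨ a = b := by
  obtain ⟨γ, hγ, hint⟩ := hG
  have hne : ∀ v, (γ v).Nonempty := fun v => (hγ v).isPathConnected.nonempty
  choose pt hpt using hne
  have J : ∀ i j (h : i < j), JoinedIn (⋃ w ∈ (P i j h).support, γ w) (pt (x i)) (pt (x j)) :=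
    fun i j h => walk_joinedIn γ hγ (fun u v h => (hint u v).2 (Or.inl h)) _ _ (hpt _) _ (hpt _)
  let e := Complex.equivRealProdCLM.symm
  let f : Fin 5 → Fin 5 → ℝ → ℂ := fun i j t =>
    if h : i < j then e ((J i j h).somePath.extend t) else 0
  obtain ⟨i, j, k, l, hij, hkl, h1, h2, h3, h4, s, t, hst⟩ := k5_crossing (fun i => e (pt (x i))) f
    (by
      intro i j h
      simp only [f, h, dite_true]
      exact e.continuous.comp (Path.continuous_extend _))
    (by intro i j h; simp [f, h]) (by intro i j h; simp [f, h])
  refine ⟨i, j, k, l, hij, hkl, h1, h2, h3, h4, ?_⟩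
  simp only [f, hij, hkl, dite_true] at hst
  have hst := e.injective hst
  have m : ∀ i j (h : i < j) t, (J i j h).somePath.extend t ∈ ⋃ w ∈ (P i j h).support, γ w := by
    intro i j h t
    exact (J i j h).somePath_mem _
  have m1 := m i j hij s
  have m2 := m k l hkl t
  rw [← hst] at m2
  simp only [Set.mem_iUnion] at m1 m2
  obtain ⟨a, ha, ha'⟩ := m1
  obtain ⟨b, hb, hb'⟩ := m2
  exact ⟨a, ha, b, hb, (hint a b).1 ⟨_, ha', hb'⟩⟩

theorem indep_lemma {ι : Type*} [Fintype ι] [DecidableEq ι]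
    {κ : ι → Type*} [∀ i, Fintype (κ i)]
    (w : ∀ i, κ i → ℝ) (hw1 : ∀ i, ∑ p, w i p = 1) (e f : ι) (hne : e ≠ f)
    (A : κ e → ℝ) (B : κ f → ℝ) :
    (∑ p, w e p * A p) * (∑ p, w f p * B p) =
      ∑ c : ∀ i, κ i, (∏ i, w i (c i)) * (A (c e) * B (c f)) := by
  let A' : ∀ i, κ i → ℝ := Function.update (fun _ _ => 1) e A
  let B' : ∀ i, κ i → ℝ := Function.update (fun _ _ => 1) f B
  have hA : A' e = A := Function.update_self ..
  have hB : B' f = B := Function.update_self ..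
  have hA' : ∀ i, i ≠ e → A' i = fun _ => 1 := fun i h => Function.update_of_ne h _ _
  have hB' : ∀ i, i ≠ f → B' i = fun _ => 1 := fun i h => Function.update_of_ne h _ _
  have key := Fintype.prod_sum (fun i (p : κ i) => w i p * (A' i p * B' i p))
  have r : ∀ c : ∀ i, κ i, ∏ i, (w i (c i) * (A' i (c i) * B' i (c i)))
      = (∏ i, w i (c i)) * (A (c e) * B (c f)) := by
    intro c
    rw [Finset.prod_mul_distrib, Finset.prod_mul_distrib,
      Fintype.prod_eq_single (f := fun i => A' i (c i)) e (fun i h => by rw [hA' i h]),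
      Fintype.prod_eq_single (f := fun i => B' i (c i)) f (fun i h => by rw [hB' i h]), hA, hB]
  rw [Finset.sum_congr rfl (fun c _ => r c)] at key
  rw [← key, Fintype.prod_eq_mul e f hne]
  · rw [hA, hB, hA' f hne.symm, hB' e hne]
    simp
  · rintro i ⟨h1, h2⟩
    rw [hA' i h1, hB' i h2]
    simp [hw1]

theorem le_triple_sum {α V : Type*} [Fintype V] (J : Finset α) (T : α → V → V → ℝ)
    (nn : ∀ e a b, 0 ≤ T e a b) (e : α) (he : e ∈ J) (a b : V) :
    T e a b ≤ ∑ e ∈ J, ∑ a, ∑ b, T e a b := by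
  have h1 : T e a b ≤ ∑ b, T e a b :=
    Finset.single_le_sum (fun b _ => nn e a b) (Finset.mem_univ b)
  have h2 : ∑ b, T e a b ≤ ∑ a, ∑ b, T e a b :=
    Finset.single_le_sum (f := fun a => ∑ b, T e a b)
      (fun a _ => Finset.sum_nonneg fun b _ => nn e a b) (Finset.mem_univ a)
  have h3 : ∑ a, ∑ b, T e a b ≤ ∑ e ∈ J, ∑ a, ∑ b, T e a b :=
    Finset.single_le_sum (f := fun e => ∑ a, ∑ b, T e a b)
      (fun e _ => Finset.sum_nonneg fun a _ => Finset.sum_nonneg fun b _ => nn e a b) he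
  exact h1.trans (h2.trans h3)

theorem prob_lemma {ι V : Type*} [Fintype ι] [DecidableEq ι] [Fintype V]
    {κ : ι → Type*} [∀ i, Fintype (κ i)]
    (w : ∀ i, κ i → ℝ) (hw : ∀ i p, 0 ≤ w i p) (hw1 : ∀ i, ∑ p, w i p = 1)
    (S : ∀ i, κ i → V → ℝ) (hS : ∀ i p v, 0 ≤ S i p v) (R : V → V → ℝ) (hR : ∀ a b, 0 ≤ R a b)
    (J : Finset (ι × ι)) (hJ : ∀ e ∈ J, e.1 ≠ e.2)
    (h : ∀ c : ∀ i, κ i, ∃ e ∈ J, ∃ a b, 1 ≤ R a b * (S e.1 (c e.1) a * S e.2 (c e.2) b)) :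
    1 ≤ ∑ e ∈ J, ∑ a, ∑ b, R a b *
      ((∑ p, w e.1 p * S e.1 p a) * (∑ p, w e.2 p * S e.2 p b)) := by
  classical
  have tot : ∑ c : ∀ i, κ i, ∏ i, w i (c i) = 1 := by
    rw [← Fintype.prod_sum]; simp [hw1]
  have ind : ∀ e ∈ J, ∀ a b, (∑ p, w e.1 p * S e.1 p a) * (∑ p, w e.2 p * S e.2 p b) =
      ∑ c : ∀ i, κ i, (∏ i, w i (c i)) * (S e.1 (c e.1) a * S e.2 (c e.2) b) :=
    fun e he a b => indep_lemma w hw1 _ _ (hJ e he) (fun p => S e.1 p a) (fun p => S e.2 p b)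
  calc (1:ℝ) = ∑ c : ∀ i, κ i, (∏ i, w i (c i)) * 1 := by simp [tot]
    _ ≤ ∑ c : ∀ i, κ i, (∏ i, w i (c i)) *
        ∑ e ∈ J, ∑ a, ∑ b, R a b * (S e.1 (c e.1) a * S e.2 (c e.2) b) := by
      refine Finset.sum_le_sum fun c _ => mul_le_mul_of_nonneg_left ?_
        (Finset.prod_nonneg fun i _ => hw i _)
      obtain ⟨e, he, a, b, hab⟩ := h c
      have nn : ∀ e : ι × ι, ∀ a b, 0 ≤ R a b * (S e.1 (c e.1) a * S e.2 (c e.2) b) :=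
        fun e a b => mul_nonneg (hR _ _) (mul_nonneg (hS _ _ _) (hS _ _ _))
      exact hab.trans (le_triple_sum J (fun e a b => R a b * (S e.1 (c e.1) a * S e.2 (c e.2) b)) nn e he a b)
    _ = ∑ e ∈ J, ∑ a, ∑ b, ∑ c : ∀ i, κ i, R a b *
        ((∏ i, w i (c i)) * (S e.1 (c e.1) a * S e.2 (c e.2) b)) := by
      simp_rw [Finset.mul_sum]
      rw [Finset.sum_comm]
      refine Finset.sum_congr rfl fun e _ => ?_
      rw [Finset.sum_comm]
      refine Finset.sum_congr rfl fun a _ => ?_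
      rw [Finset.sum_comm]
      refine Finset.sum_congr rfl fun b _ => Finset.sum_congr rfl fun c _ => ?_
      ring
    _ = _ := by
      refine Finset.sum_congr rfl fun e he => Finset.sum_congr rfl fun a _ =>
        Finset.sum_congr rfl fun b _ => ?_
      rw [ind e he a b, Finset.mul_sum]

theorem exists_fifth {i j k l : Fin 5} (hij : i ≠ j) (hik : i ≠ k) (hil : i ≠ l) (hjk : j ≠ k)
    (hjl : j ≠ l) (hkl : k ≠ l) : ∃ m, ∀ t, t = i ∨ t = j ∨ t = k ∨ t = l ∨ t = m := by
  have h4 : ({i, j, k, l} : Finset (Fin 5)).card = 4 := by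
    rw [Finset.card_insert_of_notMem (by simp [*]), Finset.card_insert_of_notMem (by simp [*]),
      Finset.card_pair hkl]
  obtain ⟨m, hm⟩ : ∃ m, m ∉ ({i, j, k, l} : Finset (Fin 5)) := by
    by_contra! h
    have : ({i, j, k, l} : Finset (Fin 5)) = Finset.univ := Finset.eq_univ_iff_forall.2 h
    rw [this] at h4
    simp at h4
  have h5 : (insert m ({i, j, k, l} : Finset (Fin 5))) = Finset.univ := by
    apply Finset.eq_univ_of_card
    rw [Finset.card_insert_of_notMem hm, h4]; simp
  refine ⟨m, fun t => ?_⟩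
  have := Finset.mem_univ t
  rw [← h5] at this
  simp only [Finset.mem_insert, Finset.mem_singleton] at this
  tauto

theorem sum_embedding_le {V : Type*} [Fintype V] [DecidableEq V] (T : V → V → V → V → ℝ)
    (hT : ∀ a b c d, 0 ≤ T a b c d) {i j k l : Fin 5} (hij : i ≠ j) (hik : i ≠ k) (hil : i ≠ l)
    (hjk : j ≠ k) (hjl : j ≠ l) (hkl : k ≠ l) :
    ∑ x : Fin 5 ↪ V, T (x i) (x j) (x k) (x l) ≤
      (Fintype.card V : ℝ) * ∑ a, ∑ b, ∑ c, ∑ d, T a b c d := by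
  obtain ⟨m, hm⟩ := exists_fifth hij hik hil hjk hjl hkl
  let F : (Fin 5 ↪ V) → V × V × V × V × V := fun x => (x m, x i, x j, x k, x l)
  have hF : Function.Injective F := by
    intro x y hxy
    simp only [F, Prod.mk.injEq] at hxy
    obtain ⟨h1, h2, h3, h4, h5⟩ := hxy
    ext t
    rcases hm t with rfl | rfl | rfl | rfl | rfl <;> assumption
  let g : V × V × V × V × V → ℝ := fun y => T y.2.1 y.2.2.1 y.2.2.2.1 y.2.2.2.2
  calc ∑ x : Fin 5 ↪ V, T (x i) (x j) (x k) (x l) = ∑ x : Fin 5 ↪ V, g (F x) := rfl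
    _ = ∑ y ∈ Finset.univ.map ⟨F, hF⟩, g y := by rw [Finset.sum_map]; rfl
    _ ≤ ∑ y, g y := Finset.sum_le_sum_of_subset_of_nonneg (Finset.subset_univ _)
        (fun y _ _ => hT _ _ _ _)
    _ = _ := by
      simp only [g, Fintype.sum_prod_type]
      simp

theorem sum_R_le {V : Type*} [Fintype V] [DecidableEq V] (G : SimpleGraph V) [DecidableRel G.Adj] :
    ∑ a, ∑ b, (if G.Adj a b ∨ a = b then (1:ℝ) else 0) ≤
      2 * G.edgeFinset.card + Fintype.card V := by
  have h : ∀ a b, (if G.Adj a b ∨ a = b then (1:ℝ) else 0) ≤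
      (if G.Adj a b then 1 else 0) + (if a = b then 1 else 0) := by
    intro a b
    by_cases h1 : G.Adj a b <;> by_cases h2 : a = b <;> simp [h1, h2]
  refine (Finset.sum_le_sum fun a _ => Finset.sum_le_sum fun b _ => h a b).trans ?_
  have := G.sum_degrees_eq_twice_card_edges
  simp only [Finset.sum_add_distrib]
  have e : ∑ a, ∑ b, (if G.Adj a b then (1:ℝ) else 0) = 2 * G.edgeFinset.card := by
    rw [← Nat.cast_ofNat, ← Nat.cast_mul, ← this, Nat.cast_sum]
    refine Finset.sum_congr rfl fun a _ => ?_
    rw [Finset.sum_boole, ← G.card_neighborFinset_eq_degree, G.neighborFinset_eq_filter]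
  rw [e]
  simp

theorem flow_bounds {V : Type*} [Fintype V] (G : SimpleGraph V) (hG : G.IsStringGraph)
    (φ : ∀ u v : V, G.Path u v → ℝ) (hφ : G.IsMCFlow φ) (M : ℝ)
    (hM : ∀ w, G.congestion φ w ≤ M) (R : V → V → ℝ) (hR : ∀ a b, 0 ≤ R a b)
    (hR1 : ∀ a b, G.Adj a b ∨ a = b → R a b = 1) :
    (∀ u v : V, u ≠ v → 1 ≤ 4 * M) ∧
    ((Fintype.card V).descFactorial 5 : ℝ) ≤
      100 * (Fintype.card V * ((4 * M) * (4 * M) * ∑ a, ∑ b, R a b)) := by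
  letI := Classical.decEq V
  letI : DecidableRel G.Adj := fun _ _ => Classical.dec _
  obtain ⟨hφ0, -, hφ1⟩ := hφ
  let S : ∀ u v : V, G.Path u v → V → ℝ := fun u v p a => if a ∈ p.1.support then 1 else 0
  have hS0 : ∀ u v p a, 0 ≤ S u v p a := by
    intro u v p a; simp only [S]; split_ifs <;> norm_num
  let q : V → V → V → ℝ := fun u v a => ∑ p : G.Path u v, φ u v p * S u v p a
  have hq0 : ∀ u v a, 0 ≤ q u v a := fun u v a =>
    Finset.sum_nonneg fun p _ => mul_nonneg (hφ0 u v p).1 (hS0 u v p a)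
  have hQ : ∀ a, ∑ u, ∑ v, q u v a ≤ 4 * M := by
    intro a
    have h1 : ∑ u, ∑ v, q u v a ≤
        ∑ u, ∑ v, ∑ p : G.Path u v, 2 * (φ u v p * pathCoeff G a p.1) := by
      refine Finset.sum_le_sum fun u _ => Finset.sum_le_sum fun v _ =>
        Finset.sum_le_sum fun p _ => ?_
      have : S u v p a ≤ 2 * pathCoeff G a p.1 := by
        simp only [S, pathCoeff]
        split_ifs <;> norm_num
      nlinarith [(hφ0 u v p).1]
    have h2 : ∑ u, ∑ v, ∑ p : G.Path u v, 2 * (φ u v p * pathCoeff G a p.1) =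
        4 * G.congestion φ a := by
      simp only [← Finset.mul_sum, SimpleGraph.congestion]
      ring
    linarith [hM a]
  have hQ0 : ∀ a, 0 ≤ ∑ u, ∑ v, q u v a := fun a =>
    Finset.sum_nonneg fun u _ => Finset.sum_nonneg fun v _ => hq0 u v a
  refine ⟨?_, ?_⟩
  · intro u v huv
    have h1 : q u v u = 1 := by
      rw [← hφ1 u v huv]
      refine Finset.sum_congr rfl fun p _ => ?_
      simp [S]
    have h2 : q u v u ≤ ∑ v, q u v u :=
      Finset.single_le_sum (f := fun v => q u v u) (fun v _ => hq0 u v u) (Finset.mem_univ v)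
    have h3 : ∑ v, q u v u ≤ ∑ u', ∑ v, q u' v u :=
      Finset.single_le_sum (f := fun u' => ∑ v, q u' v u)
        (fun u' _ => Finset.sum_nonneg fun v _ => hq0 u' v u) (Finset.mem_univ u)
    linarith [hQ u]
  let ι := {e : Fin 5 × Fin 5 // e.1 < e.2}
  let J : Finset (ι × ι) := Finset.univ.filter fun e =>
    e.1.1.1 ≠ e.2.1.1 ∧ e.1.1.1 ≠ e.2.1.2 ∧ e.1.1.2 ≠ e.2.1.1 ∧ e.1.1.2 ≠ e.2.1.2
  have hJc : J.card ≤ 100 := by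
    refine (Finset.card_le_univ J).trans ?_
    have : Fintype.card ι = 10 := by decide
    rw [Fintype.card_prod, this]
  let T : V → V → V → V → ℝ := fun u v u' v' => ∑ a, ∑ b, R a b * (q u v a * q u' v' b)
  have hT0 : ∀ u v u' v', 0 ≤ T u v u' v' := fun u v u' v' =>
    Finset.sum_nonneg fun a _ => Finset.sum_nonneg fun b _ =>
      mul_nonneg (hR a b) (mul_nonneg (hq0 _ _ _) (hq0 _ _ _))
  have hx : ∀ x : Fin 5 ↪ V, 1 ≤ ∑ e ∈ J, T (x e.1.1.1) (x e.1.1.2) (x e.2.1.1) (x e.2.1.2) := by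
    intro x
    refine prob_lemma (ι := ι) (κ := fun e => G.Path (x e.1.1) (x e.1.2))
      (fun e => φ (x e.1.1) (x e.1.2)) (fun e p => (hφ0 _ _ p).1)
      (fun e => hφ1 _ _ (fun h => e.2.ne (x.injective h)))
      (fun e => S (x e.1.1) (x e.1.2)) (fun e p v => hS0 _ _ _ _) R hR J ?_ ?_
    · intro e he h
      have := (Finset.mem_filter.1 he).2.1
      rw [h] at this
      exact this rfl
    · intro c
      obtain ⟨i, j, k, l, hij, hkl, h1, h2, h3, h4, a, ha, b, hb, hab⟩ :=
        string_touch hG x (fun i j h => (c ⟨(i, j), h⟩).1)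
      refine ⟨(⟨(i, j), hij⟩, ⟨(k, l), hkl⟩), ?_, a, b, ?_⟩
      · simp [J, h1, h2, h3, h4]
      · rw [hR1 a b hab]
        simp [S, ha, hb]
  have hTs : ∑ u, ∑ v, ∑ u', ∑ v', T u v u' v' ≤ (4 * M) * (4 * M) * ∑ a, ∑ b, R a b := by
    have e : ∑ u, ∑ v, ∑ u', ∑ v', T u v u' v' =
        ∑ a, ∑ b, R a b * ((∑ u, ∑ v, q u v a) * (∑ u, ∑ v, q u v b)) := by
      have e1 : ∀ u v, ∑ u', ∑ v', T u v u' v' =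
          ∑ a, ∑ b, R a b * (q u v a * (∑ u, ∑ v, q u v b)) := by
        intro u v
        simp only [T, Finset.mul_sum]
        rw [Finset.sum_congr rfl fun u' _ => Finset.sum_comm, Finset.sum_comm]
        refine Finset.sum_congr rfl fun a _ => ?_
        rw [Finset.sum_congr rfl fun u' _ => Finset.sum_comm, Finset.sum_comm]
      simp only [e1, Finset.sum_mul]
      rw [Finset.sum_congr rfl fun u' _ => Finset.sum_comm, Finset.sum_comm]
      refine Finset.sum_congr rfl fun a _ => ?_
      rw [Finset.sum_congr rfl fun u' _ => Finset.sum_comm, Finset.sum_comm]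
      refine Finset.sum_congr rfl fun b _ => ?_
      rw [Finset.mul_sum]
      refine Finset.sum_congr rfl fun u _ => ?_
      rw [Finset.mul_sum]
    rw [e, Finset.mul_sum]
    refine Finset.sum_le_sum fun a _ => ?_
    rw [Finset.mul_sum]
    refine Finset.sum_le_sum fun b _ => ?_
    rw [mul_comm]
    refine mul_le_mul_of_nonneg_right ?_ (hR a b)
    exact mul_le_mul (hQ a) (hQ b) (hQ0 b) ((hQ0 a).trans (hQ a))
  calc ((Fintype.card V).descFactorial 5 : ℝ) = ∑ x : Fin 5 ↪ V, (1:ℝ) := by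
        simp [Fintype.card_embedding_eq]
    _ ≤ ∑ x : Fin 5 ↪ V, ∑ e ∈ J, T (x e.1.1.1) (x e.1.1.2) (x e.2.1.1) (x e.2.1.2) :=
        Finset.sum_le_sum fun x _ => hx x
    _ = ∑ e ∈ J, ∑ x : Fin 5 ↪ V, T (x e.1.1.1) (x e.1.1.2) (x e.2.1.1) (x e.2.1.2) :=
        Finset.sum_comm
    _ ≤ ∑ e ∈ J, (Fintype.card V * ((4 * M) * (4 * M) * ∑ a, ∑ b, R a b)) := by
        refine Finset.sum_le_sum fun e he => ?_
        obtain ⟨h1, h2, h3, h4⟩ := (Finset.mem_filter.1 he).2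
        refine (sum_embedding_le T hT0 e.1.2.ne h1 h2 h3 h4 e.2.2.ne).trans ?_
        exact mul_le_mul_of_nonneg_left hTs (Nat.cast_nonneg _)
    _ = J.card * (Fintype.card V * ((4 * M) * (4 * M) * ∑ a, ∑ b, R a b)) := by
        rw [Finset.sum_const, nsmul_eq_mul]
    _ ≤ _ := by
        refine mul_le_mul_of_nonneg_right (by exact_mod_cast hJc) ?_
        refine mul_nonneg (Nat.cast_nonneg _) (mul_nonneg (mul_self_nonneg _) ?_)
        exact Finset.sum_nonneg fun a _ => Finset.sum_nonneg fun b _ => hR a b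

theorem exists_flow {V : Type*} [Fintype V] (G : SimpleGraph V) (hG : G.Connected) :
    ∃ φ : ∀ u v : V, G.Path u v → ℝ, G.IsMCFlow φ := by
  letI := Classical.decEq V
  letI : DecidableRel G.Adj := fun _ _ => Classical.dec _
  have ne : ∀ u v, Nonempty (G.Path u v) := by
    intro u v
    obtain ⟨w⟩ := hG.preconnected u v
    exact ⟨w.toPath⟩
  have hpos : ∀ u v, 0 < Fintype.card (G.Path u v) := fun u v =>
    Fintype.card_pos_iff.2 (ne u v)
  refine ⟨fun u v _ => ((Fintype.card (G.Path u v) : ℝ))⁻¹, ?_, ?_, ?_⟩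
  · intro u v p
    exact ⟨by positivity, inv_le_one_of_one_le₀ (by exact_mod_cast hpos u v)⟩
  · intro u v p
    have : Fintype.card (G.Path v u) = Fintype.card (G.Path u v) :=
      Fintype.card_congr ⟨fun p => p.reverse, fun p => p.reverse,
        fun p => Subtype.ext (by simp), fun p => Subtype.ext (by simp)⟩
    simp only [this]
  · intro u v _
    rw [Finset.sum_const, nsmul_eq_mul, Finset.card_univ]
    exact mul_inv_cancel₀ (by exact_mod_cast (hpos u v).ne')

/-- **Lemma 1.** There is a constant `c > 0` such that every connected string graph
with `n` vertices and `m ≥ 1` edges satisfies `vcong(G) ≥ c·n²/√m`. -/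
theorem vcong_lower_bound_of_stringGraph :
    ∃ c : ℝ, 0 < c ∧
      ∀ (V : Type) [Fintype V] (G : SimpleGraph V) [DecidableRel G.Adj] [DecidableEq V],
        G.Connected → G.IsStringGraph → 1 ≤ G.edgeFinset.card →
        c * (Fintype.card V : ℝ) ^ 2 / Real.sqrt (G.edgeFinset.card) ≤ G.vcong := by
  refine ⟨1 / 2000, by norm_num, ?_⟩
  intro V _ G _ _ hconn hstr hm
  obtain ⟨φ0, hφ0⟩ := exists_flow G hconn
  refine le_csInf ⟨_, φ0, hφ0, rfl⟩ ?_
  rintro _ ⟨φ, hφ, rfl⟩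
  set M := ⨆ w : V, G.congestion φ w with hMdef
  have hM : ∀ w, G.congestion φ w ≤ M := fun w =>
    le_ciSup (Set.finite_range (fun w => G.congestion φ w)).bddAbove w
  obtain ⟨hb1, hb2⟩ := flow_bounds G hstr φ hφ M hM
    (fun a b => if G.Adj a b ∨ a = b then (1:ℝ) else 0)
    (fun a b => by split_ifs <;> norm_num) (fun a b h => by simp [h])
  have hRs := sum_R_le G
  set Rs := ∑ a, ∑ b, (if G.Adj a b ∨ a = b then (1:ℝ) else 0) with hRsdef
  have hne : ∃ u v : V, u ≠ v := by
    obtain ⟨e, he⟩ := Finset.card_pos.1 hm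
    induction e using Sym2.ind with
    | _ u v => exact ⟨u, v, (SimpleGraph.mem_edgeFinset.1 he : G.Adj u v).ne⟩
  obtain ⟨u, v, huv⟩ := hne
  have hM4 := hb1 u v huv
  have hcard : Fintype.card V ≤ G.edgeFinset.card + 1 := by
    have := hconn.card_vert_le_card_edgeSet_add_one
    rwa [Nat.card_eq_fintype_card, Nat.card_eq_fintype_card, ← SimpleGraph.edgeFinset_card] at this
  set n := Fintype.card V with hn
  set m := G.edgeFinset.card with hmdef
  have hm1 : (1:ℝ) ≤ m := by exact_mod_cast hm
  have hs : 0 < Real.sqrt m := Real.sqrt_pos.2 (by linarith)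
  have hs1 : 1 ≤ Real.sqrt m := by rw [Real.one_le_sqrt]; exact hm1
  have hss : Real.sqrt m ^ 2 = m := Real.sq_sqrt (by linarith)
  rw [div_le_iff₀ hs]
  have hnm : (n:ℝ) ≤ m + 1 := by exact_mod_cast hcard
  by_cases h5 : n < 5
  · have h4 : (n:ℝ) ≤ 4 := by exact_mod_cast (by omega : n ≤ 4)
    have h0 : (0:ℝ) ≤ n := Nat.cast_nonneg _
    nlinarith
  · have h5' : (5:ℝ) ≤ n := by exact_mod_cast (by omega : 5 ≤ n)
    have hd : ((n.descFactorial 5 : ℕ) : ℝ) = n * ((n - 1) * (n - 2) * (n - 3) * (n - 4)) := by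
      obtain ⟨k, hk⟩ : ∃ k, n = k + 5 := ⟨n - 5, by omega⟩
      rw [hk]
      simp only [Nat.descFactorial_succ, Nat.descFactorial_zero]
      have a4 : k + 5 - 4 = k + 1 := by omega
      have a3 : k + 5 - 3 = k + 2 := by omega
      have a2 : k + 5 - 2 = k + 3 := by omega
      have a1 : k + 5 - 1 = k + 4 := by omega
      rw [a1, a2, a3, a4]
      push_cast
      ring
    have hn0 : (0:ℝ) < n := by linarith
    have hlow : ((n:ℝ) / 5) ^ 4 ≤ (n - 1) * (n - 2) * (n - 3) * (n - 4) := by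
      have : ((n:ℝ) / 5) ^ 4 = (n / 5) * (n / 5) * (n / 5) * (n / 5) := by ring
      rw [this]
      have g1 : (0:ℝ) ≤ n - 1 := by linarith
      have g2 : (0:ℝ) ≤ n - 2 := by linarith
      have g3 : (0:ℝ) ≤ n - 3 := by linarith
      gcongr <;> linarith
    have hup : ((n:ℝ) - 1) * (n - 2) * (n - 3) * (n - 4) ≤ 100 * ((4 * M) * (4 * M) * Rs) := by
      refine le_of_mul_le_mul_left ?_ hn0
      rw [← hd]
      refine hb2.trans (le_of_eq ?_)
      ring
    have hR4 : Rs ≤ 4 * m := by linarith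
    have hup2 : 100 * ((4 * M) * (4 * M) * Rs) ≤ 100 * ((4 * M) * (4 * M) * (4 * m)) := by
      gcongr
    have hfin : ((n:ℝ) ^ 2) ^ 2 ≤ (2000 * (M * Real.sqrt m)) ^ 2 := by
      have : (2000 * (M * Real.sqrt m)) ^ 2 = 4000000 * M ^ 2 * m := by
        rw [mul_pow, mul_pow, hss]; ring
      rw [this]
      nlinarith
    have hM0 : 0 ≤ M := by linarith
    have := (sq_le_sq₀ (by positivity) (by positivity)).1 hfin
    linarith
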